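/- Let α, β ∈ (0,1], let G be the conjugate Green's function, and let f : [0,1] × [0,∞) → [0,∞) be continuous. Suppose r, R > 0 satisfy r/(1 − (3/4)^α) < R, and: (i) f(s,x) ≤ R(α+β)(2α+β) for all s ∈ [0,1] and all x ∈ [0,R]; (ii) f(s,x) ≥ r·N for all s ∈ [1/4, 3/4] and all x ∈ [r, r/(1 − (3/4)^α)], where N := ( (1 − (3/4)^α) ∫_{1/4}^{3/4} G(s,s) s^{β−1} ds )^{−1}. Then there exists a continuous nonnegative function x* : [0,1] → ℝ satisfying x*(t) = ∫₀¹ G(t,s) f(s, x*(s)) s^{β−1} ds for all t ∈ [0,1], and such that r ≤ min over t ∈ [1/4,3/4] of x*(t) and max over t ∈ [0,1] of x*(t) ≤ R. -/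

import Mathlib

open MeasureTheory Filter Topology Set

noncomputable section Helpers

/-- Green kernel, in a form that is manifestly Lipschitz in `t ^ α`. -/
def kern (α t s : ℝ) : ℝ := (min (s ^ α) (t ^ α) - s ^ α * t ^ α) / α

/-- Volterra part of the kernel. -/
def volt (α t s : ℝ) : ℝ := max (t ^ α - s ^ α) 0 / α

lemma kern_lip {α : ℝ} (hα : 0 < α) {s : ℝ} (hs : s ∈ Icc (0:ℝ) 1) (t t' : ℝ) :
    |kern α t s - kern α t' s| ≤ |t ^ α - t' ^ α| / α := by
  have h0 : 0 ≤ s ^ α := Real.rpow_nonneg hs.1 _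
  have h1 : s ^ α ≤ 1 := Real.rpow_le_one hs.1 hs.2 hα.le
  unfold kern
  rw [← sub_div, abs_div, abs_of_pos hα]
  refine div_le_div_of_nonneg_right ?_ hα.le
  generalize s ^ α = σ at *
  generalize t ^ α = a
  generalize t' ^ α = b
  rcases le_total σ a with h | h <;> rcases le_total σ b with h' | h' <;>
    simp only [min_eq_left, min_eq_right, h, h'] <;>
    rcases le_total a b with hab | hab <;>
    first
    | rw [abs_of_nonneg (sub_nonneg.2 hab), abs_le]
    | rw [abs_of_nonpos (sub_nonpos.2 hab), abs_le]
  all_goals constructor <;> nlinarith [mul_nonneg h0 (sub_nonneg.2 hab), mul_nonneg (sub_nonneg.2 h1) (sub_nonneg.2 hab)]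

lemma kern_nonneg {α : ℝ} (hα : 0 < α) {s t : ℝ} (hs : s ∈ Icc (0:ℝ) 1) (ht : t ∈ Icc (0:ℝ) 1) :
    0 ≤ kern α t s := by
  have h0 : 0 ≤ s ^ α := Real.rpow_nonneg hs.1 _
  have h1 : s ^ α ≤ 1 := Real.rpow_le_one hs.1 hs.2 hα.le
  have h0' : 0 ≤ t ^ α := Real.rpow_nonneg ht.1 _
  have h1' : t ^ α ≤ 1 := Real.rpow_le_one ht.1 ht.2 hα.le
  unfold kern
  apply div_nonneg _ hα.le
  rcases le_total (s ^ α) (t ^ α) with h | h <;> simp only [min_eq_left, min_eq_right, h] <;> nlinarith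

lemma kern_le_diag {α : ℝ} (hα : 0 < α) {s t : ℝ} (hs : s ∈ Icc (0:ℝ) 1) (ht : t ∈ Icc (0:ℝ) 1) :
    kern α t s ≤ kern α s s := by
  have h0 : 0 ≤ s ^ α := Real.rpow_nonneg hs.1 _
  have h1 : s ^ α ≤ 1 := Real.rpow_le_one hs.1 hs.2 hα.le
  unfold kern
  gcongr ?_ / α
  rw [min_self]
  rcases le_total (s ^ α) (t ^ α) with h | h <;> simp only [min_eq_left, min_eq_right, h] <;> nlinarith

lemma kern_ge_diag {α : ℝ} (hα : 0 < α) (hα1 : α ≤ 1) {s t : ℝ} (hs : s ∈ Icc (0:ℝ) 1)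
    (ht : t ∈ Icc (1/4:ℝ) (3/4)) :
    (1 - (3/4:ℝ) ^ α) * kern α s s ≤ kern α t s := by
  have h0 : 0 ≤ s ^ α := Real.rpow_nonneg hs.1 _
  have h1 : s ^ α ≤ 1 := Real.rpow_le_one hs.1 hs.2 hα.le
  have h2 : t ^ α ≤ (3/4:ℝ) ^ α := Real.rpow_le_rpow (by linarith [ht.1]) ht.2 hα.le
  have h3 : (1/4:ℝ) ^ α ≤ t ^ α := Real.rpow_le_rpow (by norm_num) ht.1 hα.le
  have h4 : (3/4:ℝ) ≤ (3/4:ℝ) ^ α := by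
    simpa using Real.rpow_le_rpow_of_exponent_ge (x := (3/4:ℝ)) (by norm_num) (by norm_num) hα1
  have h5 : (1/4:ℝ) ≤ (1/4:ℝ) ^ α := by
    simpa using Real.rpow_le_rpow_of_exponent_ge (x := (1/4:ℝ)) (by norm_num) (by norm_num) hα1
  have h6 : (3/4:ℝ) ^ α ≤ 1 := Real.rpow_le_one (by norm_num) (by norm_num) hα.le
  unfold kern
  rw [← mul_div_assoc]
  gcongr ?_ / α
  rw [min_self]
  generalize s ^ α = σ at *
  generalize t ^ α = τ at *
  generalize (3/4:ℝ) ^ α = p at *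
  generalize (1/4:ℝ) ^ α = q at *
  have h01 : 0 ≤ σ * (1 - σ) := mul_nonneg h0 (by linarith)
  rcases le_total σ τ with h | h <;> simp only [min_eq_left, min_eq_right, h]
  · nlinarith [mul_nonneg h0 (show 0 ≤ p - τ by linarith), mul_nonneg (mul_nonneg h0 h0) (show 0 ≤ 1 - p by linarith)]
  · nlinarith [mul_nonneg (show 0 ≤ 1 - σ by linarith) (show 0 ≤ τ - (1 - p) by linarith),
      mul_nonneg (mul_nonneg (show 0 ≤ 1 - σ by linarith) (show 0 ≤ 1 - σ by linarith)) (show 0 ≤ 1 - p by linarith)]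

lemma kern_eq_volt {α : ℝ} (hα : 0 < α) {s : ℝ} (hs : s ∈ Icc (0:ℝ) 1) (t : ℝ) :
    kern α t s = t ^ α * volt α 1 s - volt α t s := by
  have h1 : s ^ α ≤ 1 := Real.rpow_le_one hs.1 hs.2 hα.le
  unfold kern volt
  rw [Real.one_rpow, max_eq_left (by linarith)]
  rcases le_total (s ^ α) (t ^ α) with h | h
  · rw [min_eq_left h, max_eq_left (by linarith)]; ring
  · rw [min_eq_right h, max_eq_right (by linarith)]; ring

lemma kern_meas (α t : ℝ) : Measurable (kern α t) := by unfold kern; fun_prop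
lemma volt_meas (α t : ℝ) : Measurable (volt α t) := by unfold volt; fun_prop

lemma volt_nonneg {α : ℝ} (hα : 0 < α) (t s : ℝ) : 0 ≤ volt α t s :=
  div_nonneg (le_max_right _ _) hα.le

lemma volt_le {α : ℝ} (hα : 0 < α) {t s : ℝ} (ht : 0 ≤ t) (hs : 0 ≤ s) :
    volt α t s ≤ t ^ α / α := by
  unfold volt
  gcongr
  exact max_le (by linarith [Real.rpow_nonneg hs α]) (Real.rpow_nonneg ht α)

/-- recursion -/
def shoot (c : ℕ → ℝ) (H : ℕ → ℕ → ℝ → ℝ) : ℕ → ℝ → ℝ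
  | j => fun m => m * c j - ∑ i : Fin j, H j i (shoot c H i m)
termination_by j => j
decreasing_by exact i.2

lemma shoot_eq (c : ℕ → ℝ) (H : ℕ → ℕ → ℝ → ℝ) (j : ℕ) (m : ℝ) :
    shoot c H j m = m * c j - ∑ i ∈ Finset.range j, H j i (shoot c H i m) := by
  rw [shoot, Finset.sum_range]

lemma shoot_cont (c : ℕ → ℝ) (H : ℕ → ℕ → ℝ → ℝ) (hH : ∀ j i, Continuous (H j i)) (j : ℕ) :
    Continuous (shoot c H j) := by
  induction j using Nat.strong_induction_on with
  | _ j ih =>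
    have : shoot c H j = fun m => m * c j - ∑ i ∈ Finset.range j, H j i (shoot c H i m) := by
      funext m; exact shoot_eq c H j m
    rw [this]
    refine (continuous_id.mul continuous_const).sub (continuous_finsetSum _ fun i hi => ?_)
    exact (hH j i).comp (ih i (Finset.mem_range.1 hi))

lemma int_bdd {μ : Measure ℝ} (hμ : μ = volume.restrict (Ioc (0:ℝ) 1)) {w : ℝ → ℝ}
    (hw : Integrable w μ) (hw0 : ∀ s ∈ Ioc (0:ℝ) 1, 0 ≤ w s) {g : ℝ → ℝ} (hg : Measurable g) (C : ℝ)
    (hgC : ∀ s ∈ Ioc (0:ℝ) 1, |g s| ≤ C) : Integrable (fun s => g s * w s) μ := by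
  refine Integrable.mono' (hw.const_mul C) (hg.aestronglyMeasurable.mul hw.aestronglyMeasurable) ?_
  rw [hμ]
  refine ae_restrict_of_forall_mem measurableSet_Ioc fun s hs => ?_
  rw [Real.norm_eq_abs, abs_mul, abs_of_nonneg (hw0 s hs)]
  exact mul_le_mul_of_nonneg_right (hgC s hs) (hw0 s hs)

lemma discrete_fp {α : ℝ} (hα : 0 < α) {μ : Measure ℝ} (hμ : μ = volume.restrict (Ioc (0:ℝ) 1))
    {w : ℝ → ℝ} (hw : Integrable w μ) (hw0 : ∀ s ∈ Ioc (0:ℝ) 1, 0 ≤ w s)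
    {h : ℝ → ℝ → ℝ} (hm : Measurable (Function.uncurry h)) (hc : ∀ s, Continuous (h s)) {M : ℝ}
    (h0 : ∀ s x, 0 ≤ h s x) (hM : ∀ s x, h s x ≤ M) (n : ℕ) (hn : 0 < n) :
    ∃ u : ℝ → ℝ, Measurable u ∧ ∀ s ∈ Ioc (0:ℝ) 1,
      u s = ∫ σ, kern α ((⌊n * s⌋₊ : ℕ) / (n:ℝ)) σ * h σ (u σ) * w σ ∂μ := by
  have hn' : (0:ℝ) < n := by exact_mod_cast hn
  have hae : ∀ {p : ℝ → Prop}, (∀ s ∈ Ioc (0:ℝ) 1, p s) → ∀ᵐ s ∂μ, p s := by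
    intro p hp; rw [hμ]; exact ae_restrict_of_forall_mem measurableSet_Ioc hp
  have hM0 : 0 ≤ M := (h0 0 0).trans (hM 0 0)
  have hfl : ∀ i : ℕ, MeasurableSet {s : ℝ | ⌊(n:ℝ) * s⌋₊ = i} := fun i =>
    (Nat.measurable_floor.comp (measurable_const.mul measurable_id)) (measurableSet_singleton i)
  have hmv : ∀ v : ℝ → ℝ, Measurable v → Measurable (fun s => h s (v s)) := fun v hv =>
    hm.comp (measurable_id.prodMk hv)
  have hVb : ∀ t : ℝ, 0 ≤ t → ∀ v : ℝ → ℝ, ∀ s ∈ Ioc (0:ℝ) 1,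
      |volt α t s * h s (v s)| ≤ t ^ α / α * M := by
    intro t ht v s hs
    rw [abs_of_nonneg (mul_nonneg (volt_nonneg hα _ _) (h0 _ _))]
    exact mul_le_mul (volt_le hα ht hs.1.le) (hM _ _) (h0 _ _) (div_nonneg (Real.rpow_nonneg ht _) hα.le)
  have hVint : ∀ t : ℝ, 0 ≤ t → ∀ v : ℝ → ℝ, Measurable v →
      Integrable (fun s => volt α t s * h s (v s) * w s) μ := fun t ht v hv =>
    int_bdd hμ hw hw0 ((volt_meas α t).mul (hmv v hv)) _ (hVb t ht v)
  have htj : ∀ j : ℕ, (0:ℝ) ≤ (j:ℝ) / n := fun j => by positivity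
  let F : ℕ → ℕ → ℝ → ℝ → ℝ := fun j i v s =>
    ({s : ℝ | ⌊(n:ℝ) * s⌋₊ = i}).indicator (fun s => volt α (j / n) s * h s v * w s) s
  have hFint : ∀ j i v, Integrable (F j i v) μ := fun j i v =>
    (hVint _ (htj j) (fun _ => v) measurable_const).indicator (hfl i)
  let H : ℕ → ℕ → ℝ → ℝ := fun j i v => ∫ s, F j i v s ∂μ
  have hFb : ∀ j i v, ∀ s ∈ Ioc (0:ℝ) 1, 0 ≤ F j i v s ∧ F j i v s ≤ ((j:ℝ) / n) ^ α / α * M * w s := by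
    intro j i v s hs
    have hb := hVb _ (htj j) (fun _ => v) s hs
    have hwb := hw0 s hs
    have e1 : 0 ≤ volt α (j / n) s * h s v := mul_nonneg (volt_nonneg hα _ _) (h0 _ _)
    rw [abs_of_nonneg e1] at hb
    by_cases hh : ⌊(n:ℝ) * s⌋₊ = i
    · have : F j i v s = volt α (j / n) s * h s v * w s := Set.indicator_of_mem (s := {s : ℝ | ⌊(n:ℝ) * s⌋₊ = i}) hh _
      rw [this]
      exact ⟨mul_nonneg e1 hwb, mul_le_mul_of_nonneg_right hb hwb⟩
    · have : F j i v s = 0 := Set.indicator_of_notMem (s := {s : ℝ | ⌊(n:ℝ) * s⌋₊ = i}) hh _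
      rw [this]
      exact ⟨le_rfl, mul_nonneg (e1.trans hb) hwb⟩
  have hHc : ∀ j i, Continuous (H j i) := by
    intro j i
    refine continuous_of_dominated (bound := fun s => ((j:ℝ) / n) ^ α / α * M * w s)
      (fun v => (hFint j i v).aestronglyMeasurable) ?_ (hw.const_mul _) ?_
    · intro v
      refine hae fun s hs => ?_
      rw [Real.norm_eq_abs, abs_of_nonneg (hFb j i v s hs).1]
      exact (hFb j i v s hs).2
    · refine Eventually.of_forall fun s => ?_
      by_cases hh : ⌊(n:ℝ) * s⌋₊ = i
      · have : (fun v => F j i v s) = fun v => volt α (j / n) s * h s v * w s := by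
          funext v; exact Set.indicator_of_mem (s := {s : ℝ | ⌊(n:ℝ) * s⌋₊ = i}) hh _
        rw [this]
        exact (continuous_const.mul (hc s)).mul continuous_const
      · have : (fun v => F j i v s) = fun v => 0 := by
          funext v; exact Set.indicator_of_notMem (s := {s : ℝ | ⌊(n:ℝ) * s⌋₊ = i}) hh _
        rw [this]
        exact continuous_const
  let c : ℕ → ℝ := fun j => ((j:ℝ) / n) ^ α
  have hcn : c n = 1 := by simp [c, div_self hn'.ne']
  obtain ⟨m, hm0⟩ : ∃ m, shoot c H n m = 0 := by
    refine mem_range_of_exists_le_of_exists_ge (shoot_cont c H hHc n) ⟨0, ?_⟩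
      ⟨∑ i ∈ Finset.range n, ∫ s, ((n:ℝ) / n) ^ α / α * M * w s ∂μ, ?_⟩
    · rw [shoot_eq, zero_mul, zero_sub, neg_nonpos]
      exact Finset.sum_nonneg fun i _ => integral_nonneg_of_ae (hae fun s hs => (hFb _ _ _ s hs).1)
    · rw [shoot_eq, hcn, mul_one, sub_nonneg]
      exact Finset.sum_le_sum fun i _ => integral_mono_ae (hFint _ _ _) (hw.const_mul _)
        (hae fun s hs => (hFb _ _ _ s hs).2)
  let u : ℝ → ℝ := fun s => shoot c H ⌊(n:ℝ) * s⌋₊ m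
  have hu : Measurable u :=
    (measurable_of_countable (fun k : ℕ => shoot c H k m)).comp
      (Nat.measurable_floor.comp (measurable_const.mul measurable_id))
  have hsum : ∀ j : ℕ, shoot c H j m = m * c j - ∫ s, volt α (j / n) s * h s (u s) * w s ∂μ := by
    intro j
    rw [shoot_eq]
    congr 1
    change ∑ i ∈ Finset.range j, ∫ s, F j i (shoot c H i m) s ∂μ = _
    rw [← integral_finsetSum _ (fun i _ => hFint j i _)]
    refine integral_congr_ae (hae fun s hs => ?_)
    have e : ∀ i, F j i (shoot c H i m) s
        = if i = ⌊(n:ℝ) * s⌋₊ then volt α (j / n) s * h s (u s) * w s else 0 := by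
      intro i
      by_cases hh : ⌊(n:ℝ) * s⌋₊ = i
      · rw [if_pos hh.symm]
        subst hh
        exact Set.indicator_of_mem (s := {s' : ℝ | ⌊(n:ℝ) * s'⌋₊ = ⌊(n:ℝ) * s⌋₊}) rfl _
      · rw [if_neg (fun h => hh h.symm)]
        exact Set.indicator_of_notMem (s := {s : ℝ | ⌊(n:ℝ) * s⌋₊ = i}) hh _
    simp only [e, Finset.sum_ite_eq', Finset.mem_range]
    split_ifs with hlt
    · rfl
    · have h1 : (j:ℝ) ≤ n * s := by
        have : (j:ℝ) ≤ (⌊(n:ℝ) * s⌋₊ : ℕ) := by exact_mod_cast not_lt.1 hlt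
        exact this.trans (Nat.floor_le (mul_nonneg hn'.le hs.1.le))
      have h2 : (j:ℝ) / n ≤ s := by rw [div_le_iff₀ hn']; linarith
      have h3 : ((j:ℝ) / n) ^ α ≤ s ^ α := Real.rpow_le_rpow (htj j) h2 hα.le
      have : volt α (j / n) s = 0 := by
        unfold volt; rw [max_eq_right (by linarith), zero_div]
      rw [this]; simp
  have hmm : m = ∫ s, volt α 1 s * h s (u s) * w s ∂μ := by
    have := hsum n
    rw [hm0, hcn, div_self hn'.ne'] at this
    linarith
  refine ⟨u, hu, fun s hs => ?_⟩
  change shoot c H ⌊(n:ℝ) * s⌋₊ m = _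
  generalize ⌊(n:ℝ) * s⌋₊ = j
  rw [hsum j, mul_comm]
  nth_rw 1 [hmm]
  rw [← integral_const_mul, ← integral_sub ((hVint 1 zero_le_one u hu).const_mul _) (hVint _ (htj j) u hu)]
  refine integral_congr_ae (hae fun s hs => ?_)
  simp only [kern_eq_volt hα (Ioc_subset_Icc_self hs), c]
  ring

lemma exists_fp {α : ℝ} (hα : 0 < α) {μ : Measure ℝ} (hμ : μ = volume.restrict (Ioc (0:ℝ) 1))
    {w : ℝ → ℝ} (hw : Integrable w μ) (hw0 : ∀ s ∈ Ioc (0:ℝ) 1, 0 ≤ w s)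
    {h : ℝ → ℝ → ℝ} (hm : Measurable (Function.uncurry h)) (hc : ∀ s, Continuous (h s)) {M : ℝ}
    (h0 : ∀ s x, 0 ≤ h s x) (hM : ∀ s x, h s x ≤ M) :
    ∃ x : ℝ → ℝ, Continuous x ∧ ∀ t ∈ Icc (0:ℝ) 1,
      x t = ∫ s, kern α t s * h s (x s) * w s ∂μ := by
  have hae : ∀ {p : ℝ → Prop}, (∀ s ∈ Ioc (0:ℝ) 1, p s) → ∀ᵐ s ∂μ, p s := by
    intro p hp; rw [hμ]; exact ae_restrict_of_forall_mem measurableSet_Ioc hp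
  have hM0 : 0 ≤ M := (h0 0 0).trans (hM 0 0)
  have hmv : ∀ v : ℝ → ℝ, Measurable v → Measurable (fun s => h s (v s)) := fun v hv =>
    hm.comp (measurable_id.prodMk hv)
  have hk0 : ∀ s, kern α 0 s = 0 ∨ s < 0 := by
    intro s
    rcases lt_or_ge s 0 with hs | hs
    · exact Or.inr hs
    · left
      unfold kern
      rw [Real.zero_rpow hα.ne', min_eq_right (Real.rpow_nonneg hs _)]; simp
  have hkb : ∀ t : ℝ, ∀ v : ℝ → ℝ, ∀ s ∈ Ioc (0:ℝ) 1,
      |kern α t s * h s (v s)| ≤ |t ^ α| / α * M := by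
    intro t v s hs
    have h1 := kern_lip hα (Ioc_subset_Icc_self hs) t 0
    rw [(hk0 s).resolve_right (by linarith [hs.1]), Real.zero_rpow hα.ne', sub_zero, sub_zero] at h1
    rw [abs_mul, abs_of_nonneg (h0 _ _)]
    exact mul_le_mul h1 (hM _ _) (h0 _ _) (by positivity)
  have hkint : ∀ t : ℝ, ∀ v : ℝ → ℝ, Measurable v →
      Integrable (fun s => kern α t s * h s (v s) * w s) μ := fun t v hv =>
    int_bdd hμ hw hw0 ((kern_meas α t).mul (hmv v hv)) _ (hkb t v)
  let A : (ℝ → ℝ) → ℝ → ℝ := fun v t => ∫ s, kern α t s * h s (v s) * w s ∂μ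
  let W : ℝ := ∫ s, w s ∂μ
  have hAlip : ∀ v, Measurable v → ∀ t t', |A v t - A v t'| ≤ |t ^ α - t' ^ α| / α * M * W := by
    intro v hv t t'
    change |(∫ s, kern α t s * h s (v s) * w s ∂μ) - ∫ s, kern α t' s * h s (v s) * w s ∂μ| ≤ _
    rw [← integral_sub (hkint t v hv) (hkint t' v hv), ← Real.norm_eq_abs, ← integral_const_mul]
    refine norm_integral_le_of_norm_le (hw.const_mul _) (hae fun s hs => ?_)
    have e : kern α t s * h s (v s) * w s - kern α t' s * h s (v s) * w s
      = (kern α t s - kern α t' s) * h s (v s) * w s := by ring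
    rw [e, Real.norm_eq_abs, abs_mul, abs_mul, abs_of_nonneg (hw0 s hs), abs_of_nonneg (h0 _ _)]
    exact mul_le_mul_of_nonneg_right (mul_le_mul (kern_lip hα (Ioc_subset_Icc_self hs) _ _) (hM _ _) (h0 _ _)
      (by positivity)) (hw0 s hs)
  have hrc : Continuous (fun t : ℝ => t ^ α) := Real.continuous_rpow_const hα.le
  have hmod : ∀ t₀ : ℝ, Tendsto (fun t : ℝ => |t₀ ^ α - t ^ α| / α * M * W) (𝓝 t₀) (𝓝 0) := by
    intro t₀
    have : Continuous (fun t : ℝ => |t₀ ^ α - t ^ α| / α * M * W) := by fun_prop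
    simpa using this.tendsto t₀
  have hAc : ∀ v, Measurable v → Continuous (A v) := by
    intro v hv
    rw [continuous_iff_continuousAt]
    intro t₀
    rw [ContinuousAt, tendsto_iff_dist_tendsto_zero]
    refine squeeze_zero (fun _ => dist_nonneg) (fun t => ?_) (hmod t₀)
    rw [dist_comm, Real.dist_eq]
    exact hAlip v hv _ _
  choose u hum hu using fun n : ℕ => discrete_fp hα hμ hw hw0 hm hc h0 hM (n+1) (Nat.succ_pos n)
  let X : ℕ → BoundedContinuousFunction (Icc (0:ℝ) 1) ℝ := fun n =>
    BoundedContinuousFunction.mkOfCompact ⟨fun t => A (u n) t, (hAc _ (hum n)).comp continuous_subtype_val⟩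
  have hX : ∀ n t, X n t = A (u n) t := fun n t => rfl
  have hA0 : ∀ v, A v 0 = 0 := by
    intro v
    refine integral_eq_zero_of_ae (hae fun s hs => ?_)
    simp [(hk0 s).resolve_right (by linarith [hs.1])]
  have hW : 0 ≤ W := integral_nonneg_of_ae (hae hw0)
  have hcomp : IsCompact (closure (range X)) := by
    refine BoundedContinuousFunction.arzela_ascoli (Icc (-(1 / α * M * W)) (1 / α * M * W)) isCompact_Icc (range X) ?_ ?_
    · rintro _ t ⟨n, rfl⟩
      rw [hX]
      have := hAlip (u n) (hum n) t 0
      rw [hA0, sub_zero, Real.zero_rpow hα.ne', sub_zero] at this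
      have h2 : |((t:ℝ)) ^ α| ≤ 1 := by
        rw [abs_of_nonneg (Real.rpow_nonneg t.2.1 _)]
        exact Real.rpow_le_one t.2.1 t.2.2 hα.le
      rw [mem_Icc, ← abs_le]
      refine this.trans ?_
      gcongr
    · intro t₀
      refine Metric.equicontinuousAt_of_continuity_modulus
        (fun t : Icc (0:ℝ) 1 => |(t₀:ℝ) ^ α - (t:ℝ) ^ α| / α * M * W) ?_ _ ?_
      · exact (hmod t₀).comp (continuous_subtype_val.tendsto t₀)
      · refine Eventually.of_forall fun t => ?_
        rintro ⟨_, n, rfl⟩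
        exact hAlip (u n) (hum n) _ _
  obtain ⟨Y, -, φ, hφ, hlim⟩ := hcomp.tendsto_subseq (fun n => subset_closure (mem_range_self n))
  have hunif := BoundedContinuousFunction.tendsto_iff_tendstoUniformly.1 hlim
  let x : ℝ → ℝ := fun t => Y (projIcc 0 1 zero_le_one t)
  have hxc : Continuous x := Y.continuous.comp continuous_projIcc
  have hux : ∀ s ∈ Ioc (0:ℝ) 1, Tendsto (fun k => u (φ k) s) atTop (𝓝 (x s)) := by
    intro s hs
    have hmem : ∀ k : ℕ, ((⌊((k+1:ℕ):ℝ) * s⌋₊ : ℕ) : ℝ) / ((k+1:ℕ):ℝ) ∈ Icc (0:ℝ) 1 := by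
      intro k
      refine ⟨by positivity, ?_⟩
      rw [div_le_one (by positivity)]
      refine (Nat.floor_le (mul_nonneg (by positivity) hs.1.le)).trans ?_
      exact mul_le_of_le_one_right (by positivity) hs.2
    have hl : Tendsto (fun k : ℕ => ((⌊((k+1:ℕ):ℝ) * s⌋₊ : ℕ) : ℝ) / ((k+1:ℕ):ℝ)) atTop (𝓝 s) := by
      have := (tendsto_nat_floor_mul_div_atTop (R := ℝ) hs.1.le).comp
        (tendsto_natCast_atTop_atTop.comp (tendsto_add_atTop_nat 1))
      refine this.congr fun k => ?_
      simp [Function.comp, mul_comm]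
    let g : ℕ → Icc (0:ℝ) 1 := fun k => ⟨_, hmem (φ k)⟩
    have hg : Tendsto g atTop (𝓝 ⟨s, Ioc_subset_Icc_self hs⟩) := by
      rw [tendsto_subtype_rng]
      exact hl.comp hφ.tendsto_atTop
    have := hunif.tendsto_comp Y.continuous.continuousAt hg
    have hxs : x s = Y ⟨s, Ioc_subset_Icc_self hs⟩ := by
      simp only [x]; rw [projIcc_of_mem zero_le_one (Ioc_subset_Icc_self hs)]
    rw [hxs]
    refine this.congr fun k => ?_
    exact (hu (φ k) s hs).symm
  refine ⟨x, hxc, fun t ht => ?_⟩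
  have hxt : x t = Y ⟨t, ht⟩ := by simp only [x]; rw [projIcc_of_mem zero_le_one ht]
  have l1 : Tendsto (fun k => A (u (φ k)) t) atTop (𝓝 (x t)) := by
    rw [hxt]; exact hunif.tendsto_at ⟨t, ht⟩
  have l2 : Tendsto (fun k => A (u (φ k)) t) atTop (𝓝 (A x t)) := by
    refine tendsto_integral_of_dominated_convergence (fun s => |t ^ α| / α * M * w s)
      (fun k => (hkint t _ (hum _)).aestronglyMeasurable) (hw.const_mul _) ?_ ?_
    · intro k
      refine hae fun s hs => ?_
      rw [Real.norm_eq_abs, abs_mul, abs_of_nonneg (hw0 s hs)]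
      exact mul_le_mul_of_nonneg_right (hkb t _ s hs) (hw0 s hs)
    · refine hae fun s hs => ?_
      exact (((hc s).tendsto _).comp (hux s hs)).const_mul _ |>.mul_const _
  exact tendsto_nhds_unique l1 l2

end Helpers


/-- main existence theorem: Let `α, β ∈ (0,1]`, let `G` be the conjugate
Green's function, and let `f : [0,1] × [0,∞) → [0,∞)` be continuous. Suppose `r, R > 0` with
`r/(1 − (3/4)^α) < R`, and (i) `f(s,x) ≤ R(α+β)(2α+β)` for `s ∈ [0,1]`, `x ∈ [0,R]`;
(ii) `f(s,x) ≥ rN` for `s ∈ [1/4,3/4]`, `x ∈ [r, r/(1 − (3/4)^α)]`, where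
`N = ((1 − (3/4)^α) ∫_{1/4}^{3/4} G(s,s) s^{β−1} ds)⁻¹`. Then the conjugate boundary value
problem has a nonnegative continuous solution `x*` of the fixed-point integral equation with
`r ≤ min_{[1/4,3/4]} x*` and `max_{[0,1]} x* ≤ R`. -/
theorem exists_positive_solution_conjugate_bvp
    (α β : ℝ) (hα : α ∈ Set.Ioc (0:ℝ) 1) (hβ : β ∈ Set.Ioc (0:ℝ) 1)
    (G : ℝ → ℝ → ℝ)
    (hG : ∀ t s : ℝ, G t s = if s ≤ t
        then (1 / α) * s ^ α * (1 - t ^ α)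
        else (1 / α) * t ^ α * (1 - s ^ α))
    (f : ℝ → ℝ → ℝ)
    (hf_cont : ContinuousOn (fun p : ℝ × ℝ => f p.1 p.2)
      (Set.Icc (0:ℝ) 1 ×ˢ Set.Ici (0:ℝ)))
    (hf_nonneg : ∀ s ∈ Set.Icc (0:ℝ) 1, ∀ x ∈ Set.Ici (0:ℝ), 0 ≤ f s x)
    (r R : ℝ) (hr : 0 < r) (hR : 0 < R)
    (hrR : r / (1 - (3/4 : ℝ) ^ α) < R)
    (N : ℝ)
    (hN : N = ((1 - (3/4 : ℝ) ^ α) * ∫ s in (1/4 : ℝ)..(3/4 : ℝ), G s s * s ^ (β - 1))⁻¹)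
    (hi : ∀ s ∈ Set.Icc (0:ℝ) 1, ∀ x ∈ Set.Icc (0:ℝ) R,
      f s x ≤ R * (α + β) * (2 * α + β))
    (hii : ∀ s ∈ Set.Icc (1/4 : ℝ) (3/4 : ℝ),
      ∀ x ∈ Set.Icc r (r / (1 - (3/4 : ℝ) ^ α)), r * N ≤ f s x) :
    ∃ x' : ℝ → ℝ, ContinuousOn x' (Set.Icc (0:ℝ) 1) ∧
      (∀ t ∈ Set.Icc (0:ℝ) 1, 0 ≤ x' t) ∧
      (∀ t ∈ Set.Icc (0:ℝ) 1,
        x' t = ∫ s in (0:ℝ)..1, G t s * f s (x' s) * s ^ (β - 1)) ∧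
      (∀ t ∈ Set.Icc (1/4 : ℝ) (3/4 : ℝ), r ≤ x' t) ∧
      (∀ t ∈ Set.Icc (0:ℝ) 1, x' t ≤ R) := by
  obtain ⟨hα0, hα1⟩ := hα
  obtain ⟨hβ0, hβ1⟩ := hβ
  have hp1 : (3/4 : ℝ) ^ α < 1 := Real.rpow_lt_one (by norm_num) (by norm_num) hα0
  have hp0 : 0 < (3/4 : ℝ) ^ α := Real.rpow_pos_of_pos (by norm_num) _
  set k : ℝ := 1 - (3/4 : ℝ) ^ α with hk
  have hk0 : 0 < k := by linarith
  have hk1 : k ≤ 1 := by linarith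
  have hrk : r ≤ r / k := by rw [le_div_iff₀ hk0]; nlinarith
  have hGk : ∀ t s : ℝ, 0 ≤ t → 0 ≤ s → G t s = kern α t s := by
    intro t s ht hs
    rw [hG]
    unfold kern
    split_ifs with h
    · rw [min_eq_left (Real.rpow_le_rpow hs h hα0.le)]; ring
    · rw [min_eq_right (Real.rpow_le_rpow ht (not_le.1 h).le hα0.le)]; ring
  set w : ℝ → ℝ := fun s => s ^ (β - 1) with hwdef
  set μ : Measure ℝ := volume.restrict (Ioc (0:ℝ) 1) with hμ
  have hae : ∀ {p : ℝ → Prop}, (∀ s ∈ Ioc (0:ℝ) 1, p s) → ∀ᵐ s ∂μ, p s := by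
    intro p hp; exact ae_restrict_of_forall_mem measurableSet_Ioc hp
  have hwi : IntervalIntegrable w volume 0 1 := intervalIntegral.intervalIntegrable_rpow' (by linarith)
  have hw : Integrable w μ := (intervalIntegrable_iff_integrableOn_Ioc_of_le zero_le_one).1 hwi
  have hw0 : ∀ s ∈ Ioc (0:ℝ) 1, 0 ≤ w s := fun s hs => Real.rpow_nonneg hs.1.le _
  -- the modified nonlinearity
  let ψ : ℝ → ℝ := (Icc (1/4:ℝ) (3/4)).indicator (fun _ => r)
  have hψm : Measurable ψ := measurable_const.indicator measurableSet_Icc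
  have hψ0 : ∀ s, 0 ≤ ψ s := fun s => Set.indicator_nonneg (fun _ _ => hr.le) s
  have hψr : ∀ s, ψ s ≤ R := by
    intro s
    by_cases h : s ∈ Icc (1/4:ℝ) (3/4)
    · simp only [ψ, Set.indicator_of_mem h]; linarith
    · simp only [ψ, Set.indicator_of_notMem h]; linarith
  let F : ℝ → ℝ → ℝ := fun s x => f (max 0 (min s 1)) (max x 0)
  have hFc : Continuous (fun p : ℝ × ℝ => F p.1 p.2) := by
    have : Continuous (fun p : ℝ × ℝ => ((max 0 (min p.1 1), max p.2 0) : ℝ × ℝ)) := by fun_prop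
    exact hf_cont.comp_continuous this fun p =>
      ⟨⟨le_max_left _ _, max_le zero_le_one (min_le_right _ _)⟩, mem_Ici.2 (le_max_right _ _)⟩
  let h : ℝ → ℝ → ℝ := fun s x => F s (max (ψ s) (min x R))
  have hm : Measurable (Function.uncurry h) := by
    have : Measurable (fun p : ℝ × ℝ => ((p.1, max (ψ p.1) (min p.2 R)) : ℝ × ℝ)) := by fun_prop
    exact hFc.measurable.comp this
  have hc : ∀ s, Continuous (h s) := fun s =>
    hFc.comp (continuous_const.prodMk (continuous_const.max (continuous_id.min continuous_const)))
  have hh : ∀ s ∈ Icc (0:ℝ) 1, ∀ x, h s x = f s (max (ψ s) (min x R)) := by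
    intro s hs x
    have e1 : max 0 (min s 1) = s := by rw [min_eq_left hs.2, max_eq_right hs.1]
    have e2 : max (max (ψ s) (min x R)) 0 = max (ψ s) (min x R) :=
      max_eq_left ((hψ0 s).trans (le_max_left _ _))
    simp only [h, F, e1, e2]
  have hs01 : ∀ s : ℝ, max 0 (min s 1) ∈ Icc (0:ℝ) 1 := fun s =>
      ⟨le_max_left _ _, max_le zero_le_one (min_le_right _ _)⟩
  have h0 : ∀ s x, 0 ≤ h s x := fun s x => hf_nonneg _ (hs01 s) _ (mem_Ici.2 (le_max_right _ _))
  have hM : ∀ s x, h s x ≤ R * (α + β) * (2 * α + β) := fun s x =>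
    hi _ (hs01 s) _ ⟨le_max_right _ _, max_le (max_le (hψr s) (min_le_right _ _)) hR.le⟩
  obtain ⟨x, hxc, hx⟩ := exists_fp hα0 hμ hw hw0 hm hc h0 hM
  have hM0 := (h0 0 0).trans (hM 0 0)
  set M := R * (α + β) * (2 * α + β) with hMdef
  have hxm : Measurable (fun s => h s (x s)) := hm.comp (measurable_id.prodMk hxc.measurable)
  have hkb : ∀ t ∈ Icc (0:ℝ) 1, ∀ s ∈ Ioc (0:ℝ) 1, |kern α t s| ≤ 1 / α := by
    intro t ht s hs
    have h1 := kern_nonneg hα0 (Ioc_subset_Icc_self hs) ht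
    rw [abs_of_nonneg h1]
    refine (kern_le_diag hα0 (Ioc_subset_Icc_self hs) ht).trans ?_
    unfold kern
    have h2 : 0 ≤ s ^ α := Real.rpow_nonneg hs.1.le _
    have h3 : s ^ α ≤ 1 := Real.rpow_le_one hs.1.le hs.2 hα0.le
    rw [min_self]
    exact div_le_div_of_nonneg_right (by nlinarith) hα0.le
  have hdm : Measurable (fun s => kern α s s) := by unfold kern; fun_prop
  have hkint : ∀ t ∈ Icc (0:ℝ) 1, Integrable (fun s => kern α t s * h s (x s) * w s) μ := by
    intro t ht
    refine int_bdd hμ hw hw0 ((kern_meas α t).mul hxm) (1 / α * M) fun s hs => ?_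
    rw [abs_mul, abs_of_nonneg (h0 _ _)]
    exact mul_le_mul (hkb t ht s hs) (hM _ _) (h0 _ _) (by positivity)
  have hx0 : ∀ t ∈ Icc (0:ℝ) 1, 0 ≤ x t := by
    intro t ht
    rw [hx t ht]
    exact integral_nonneg_of_ae (hae fun s hs => mul_nonneg (mul_nonneg
      (kern_nonneg hα0 (Ioc_subset_Icc_self hs) ht) (h0 _ _)) (hw0 s hs))
  have hdint : Integrable (fun s => kern α s s * w s) μ :=
    int_bdd hμ hw hw0 hdm (1 / α) fun s hs => hkb s (Ioc_subset_Icc_self hs) s hs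
  have hdval : ∫ s, kern α s s * w s ∂μ = 1 / ((α + β) * (2 * α + β)) := by
    rw [hμ, ← intervalIntegral.integral_of_le zero_le_one]
    have e : ∫ s in (0:ℝ)..1, kern α s s * w s
        = ∫ s in (0:ℝ)..1, (1 / α) * (s ^ (α + β - 1) - s ^ (2 * α + β - 1)) := by
      refine intervalIntegral.integral_congr_ae (Eventually.of_forall fun s hs => ?_)
      rw [uIoc_of_le zero_le_one] at hs
      simp only [kern, min_self, hwdef]
      have e1 : s ^ (α + β - 1) = s ^ α * s ^ (β - 1) := by rw [← Real.rpow_add hs.1]; ring_nf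
      have e2 : s ^ (2 * α + β - 1) = s ^ α * s ^ α * s ^ (β - 1) := by
        rw [← Real.rpow_add hs.1, ← Real.rpow_add hs.1]; ring_nf
      rw [e1, e2]; ring
    rw [e, intervalIntegral.integral_const_mul, intervalIntegral.integral_sub
      (intervalIntegral.intervalIntegrable_rpow' (by linarith))
      (intervalIntegral.intervalIntegrable_rpow' (by linarith)),
      integral_rpow (Or.inl (by linarith)), integral_rpow (Or.inl (by linarith))]
    have e1 : α + β - 1 + 1 = α + β := by ring
    have e2 : 2 * α + β - 1 + 1 = 2 * α + β := by ring
    have n1 : α + β ≠ 0 := by linarith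
    have n2 : 2 * α + β ≠ 0 := by linarith
    rw [e1, e2, Real.one_rpow, Real.one_rpow, Real.zero_rpow n1, Real.zero_rpow n2]
    field_simp
    ring
  have hxR : ∀ t ∈ Icc (0:ℝ) 1, x t ≤ R := by
    intro t ht
    have e : ∫ s, M * (kern α s s * w s) ∂μ = R := by
      rw [integral_const_mul, hdval, hMdef]
      have n1 : α + β ≠ 0 := by linarith
      have n2 : 2 * α + β ≠ 0 := by linarith
      field_simp
    rw [hx t ht, ← e]
    refine integral_mono_ae (hkint t ht) (hdint.const_mul M) (hae fun s hs => ?_)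
    have hs' := Ioc_subset_Icc_self hs
    have := mul_le_mul (kern_le_diag hα0 hs' ht) (hM s (x s)) (h0 _ _) (kern_nonneg hα0 hs' hs')
    have := mul_le_mul_of_nonneg_right this (hw0 s hs)
    simp only
    linarith
  have hsub : Icc (1/4:ℝ) (3/4) ⊆ Icc 0 1 := Icc_subset_Icc (by norm_num) (by norm_num)
  have hcone : ∀ t ∈ Icc (1/4:ℝ) (3/4), ∀ t' ∈ Icc (0:ℝ) 1, k * x t' ≤ x t := by
    intro t ht t' ht'
    rw [hx t (hsub ht), hx t' ht', ← integral_const_mul]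
    refine integral_mono_ae ((hkint t' ht').const_mul k) (hkint t (hsub ht)) (hae fun s hs => ?_)
    have hs' := Ioc_subset_Icc_self hs
    have h1 := kern_ge_diag hα0 hα1 hs' ht
    have h2 := mul_le_mul_of_nonneg_left (kern_le_diag hα0 hs' ht') hk0.le
    have h3 := mul_le_mul_of_nonneg_right (h2.trans h1) (mul_nonneg (h0 s (x s)) (hw0 s hs))
    simp only
    linarith
  have hxr : ∀ t ∈ Icc (1/4:ℝ) (3/4), r ≤ x t := by
    intro t ht
    by_contra hlt
    push Not at hlt
    have hsm : ∀ s ∈ Icc (0:ℝ) 1, x s ≤ r / k := by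
      intro s hs
      rw [le_div_iff₀ hk0]
      linarith [hcone t ht s hs]
    have hlow : ∀ s ∈ Icc (1/4:ℝ) (3/4), r * N ≤ h s (x s) := by
      intro s hs
      rw [hh s (hsub hs)]
      refine hii s hs _ ?_
      have : ψ s = r := Set.indicator_of_mem hs _
      rw [this]
      exact ⟨le_max_left _ _, max_le hrk ((min_le_left _ _).trans (hsm s (hsub hs)))⟩
    have hsub' : Ioc (1/4:ℝ) (3/4) ⊆ Ioc 0 1 := Ioc_subset_Ioc (by norm_num) (by norm_num)
    have hdI : IntegrableOn (fun s => kern α s s * w s) (Ioc (1/4:ℝ) (3/4)) :=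
      IntegrableOn.mono_set (t := Ioc (0:ℝ) 1) hdint hsub'
    have hIeq : ∫ s in (1/4 : ℝ)..(3/4 : ℝ), G s s * s ^ (β - 1)
        = ∫ s in (1/4 : ℝ)..(3/4 : ℝ), kern α s s * w s := by
      refine intervalIntegral.integral_congr fun s hs => ?_
      rw [uIcc_of_le (by norm_num)] at hs
      simp only [hGk s s (hsub hs).1 (hsub hs).1, hwdef]
    have hIpos : 0 < ∫ s in (1/4 : ℝ)..(3/4 : ℝ), kern α s s * w s := by
      refine intervalIntegral.intervalIntegral_pos_of_pos_on
        ((intervalIntegrable_iff_integrableOn_Ioc_of_le (by norm_num)).2 hdI) ?_ (by norm_num)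
      intro s hs
      have hs0 : 0 < s := by linarith [hs.1]
      have hs1 : s < 1 := by linarith [hs.2]
      have a1 : 0 < s ^ α := Real.rpow_pos_of_pos hs0 _
      have a2 : s ^ α < 1 := Real.rpow_lt_one hs0.le hs1 hα0
      refine mul_pos ?_ (Real.rpow_pos_of_pos hs0 _)
      unfold kern
      rw [min_self]
      exact div_pos (by nlinarith) hα0
    rw [hIeq] at hN
    set I := ∫ s in (1/4 : ℝ)..(3/4 : ℝ), kern α s s * w s with hI
    have hrN : 0 ≤ r * N := by rw [hN]; positivity
    have e : ∫ s in Ioc (1/4:ℝ) (3/4), (k * (r * N)) * (kern α s s * w s) = r := by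
      rw [integral_const_mul, ← intervalIntegral.integral_of_le (by norm_num), ← hI, hN]
      field_simp
    have l1 : ∫ s in Ioc (1/4:ℝ) (3/4), (k * (r * N)) * (kern α s s * w s)
        ≤ ∫ s in Ioc (1/4:ℝ) (3/4), kern α t s * h s (x s) * w s := by
      refine setIntegral_mono_on (hdI.const_mul _)
        (IntegrableOn.mono_set (t := Ioc (0:ℝ) 1) (hkint t (hsub ht)) hsub') measurableSet_Ioc fun s hs => ?_
      have hs' := Ioc_subset_Icc_self (hsub' hs)
      have b := mul_le_mul (kern_ge_diag hα0 hα1 hs' ht) (hlow s (Ioc_subset_Icc_self hs)) hrN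
        (kern_nonneg hα0 hs' (hsub ht))
      have := mul_le_mul_of_nonneg_right b (hw0 s (hsub' hs))
      linarith
    have l2 : ∫ s in Ioc (1/4:ℝ) (3/4), kern α t s * h s (x s) * w s ≤ x t := by
      rw [hx t (hsub ht)]
      refine setIntegral_mono_set (t := Ioc (0:ℝ) 1) (hkint t (hsub ht)) (hae fun s hs => ?_)
        (HasSubset.Subset.eventuallyLE hsub')
      exact mul_nonneg (mul_nonneg
        (kern_nonneg hα0 (Ioc_subset_Icc_self hs) (hsub ht)) (h0 _ _)) (hw0 s hs)
    linarith
  refine ⟨x, hxc.continuousOn, hx0, fun t ht => ?_, hxr, hxR⟩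
  rw [intervalIntegral.integral_of_le zero_le_one, hx t ht]
  refine integral_congr_ae (hae fun s hs => ?_)
  have hs' := Ioc_subset_Icc_self hs
  have e : max (ψ s) (min (x s) R) = x s := by
    rw [min_eq_left (hxR s hs')]
    refine max_eq_right ?_
    by_cases hm : s ∈ Icc (1/4:ℝ) (3/4)
    · simp only [ψ, Set.indicator_of_mem hm]; exact hxr s hm
    · simp only [ψ, Set.indicator_of_notMem hm]; exact hx0 s hs'
  simp only [hGk t s ht.1 hs'.1, hh s hs', e, hwdef]
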